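/- Let s : ℝ × ℝ³ → ℝ be smooth, and let A, A' : ℝ × ℝ³ → ℝ be smooth functions that are analytic in time, i.e. for each fixed x ∈ ℝ³ the maps t ↦ A(t,x) and t ↦ A'(t,x) are real-analytic on all of ℝ. Suppose both satisfy the same inhomogeneous wave equation ∂_t² A = Δ_x A − s and ∂_t² A' = Δ_x A' − s, and that they share initial data at time t₀: A(t₀,·) = A'(t₀,·) and ∂_t A(t₀,·) = ∂_t A'(t₀,·). Then A = A' everywhere. -/

import Mathlib

/-- Partial derivative with respect to the time variable of a function on `ℝ × ℝ³`. -/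
noncomputable def dt (f : ℝ × (Fin 3 → ℝ) → ℝ) : ℝ × (Fin 3 → ℝ) → ℝ :=
  fun p => fderiv ℝ f p (1, 0)

/-- Laplacian in the spatial variables of a function on `ℝ × ℝ³`. -/
noncomputable def lap (f : ℝ × (Fin 3 → ℝ) → ℝ) : ℝ × (Fin 3 → ℝ) → ℝ :=
  fun p => ∑ i : Fin 3,
    fderiv ℝ (fun q => fderiv ℝ f q (0, Pi.single i 1)) p (0, Pi.single i 1)

noncomputable def dirD (v : ℝ × (Fin 3 → ℝ)) (f : ℝ × (Fin 3 → ℝ) → ℝ) : ℝ × (Fin 3 → ℝ) → ℝ :=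
  fun p => fderiv ℝ f p v

theorem dirD_smooth (v : ℝ × (Fin 3 → ℝ)) {f : ℝ × (Fin 3 → ℝ) → ℝ}
    (hf : ContDiff ℝ (⊤ : ℕ∞) f) : ContDiff ℝ (⊤ : ℕ∞) (dirD v f) :=
  (hf.fderiv_right (m := (⊤ : ℕ∞)) (by exact_mod_cast le_top)).clm_apply contDiff_const

theorem diff_of_smooth {f : ℝ × (Fin 3 → ℝ) → ℝ}
    (hf : ContDiff ℝ (⊤ : ℕ∞) f) : Differentiable ℝ f :=
  hf.differentiable (by simp)

theorem dirD_comm (v w : ℝ × (Fin 3 → ℝ)) {f : ℝ × (Fin 3 → ℝ) → ℝ}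
    (hf : ContDiff ℝ (⊤ : ℕ∞) f) : dirD v (dirD w f) = dirD w (dirD v f) := by
  funext p
  have hsym : IsSymmSndFDerivAt ℝ f p :=
    hf.contDiffAt.isSymmSndFDerivAt (by simp [minSmoothness_of_isRCLikeNormedField]; exact WithTop.coe_le_coe.mpr le_top)
  have hd : DifferentiableAt ℝ (fderiv ℝ f) p :=
    ((hf.fderiv_right (m := (⊤ : ℕ∞)) (by exact_mod_cast le_top)).differentiable (by simp)) p
  have key : ∀ a b : ℝ × (Fin 3 → ℝ),
      dirD a (dirD b f) p = fderiv ℝ (fderiv ℝ f) p a b := by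
    intro a b
    change fderiv ℝ (fun q => fderiv ℝ f q b) p a = _
    rw [fderiv_clm_apply hd (differentiableAt_const b)]
    simp
  rw [key, key]
  exact hsym v w

theorem dirD_sub (v : ℝ × (Fin 3 → ℝ)) {f g : ℝ × (Fin 3 → ℝ) → ℝ}
    (hf : ContDiff ℝ (⊤ : ℕ∞) f) (hg : ContDiff ℝ (⊤ : ℕ∞) g) :
    dirD v (f - g) = dirD v f - dirD v g := by
  funext p
  simp [dirD, fderiv_sub (diff_of_smooth hf p) (diff_of_smooth hg p)]

theorem dt_eq (f : ℝ × (Fin 3 → ℝ) → ℝ) : dt f = dirD (1, 0) f := rfl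

theorem lap_eq (f : ℝ × (Fin 3 → ℝ) → ℝ) :
    lap f = fun p => ∑ i : Fin 3, dirD (0, Pi.single i 1) (dirD (0, Pi.single i 1) f) p := rfl

theorem dt_lap {f : ℝ × (Fin 3 → ℝ) → ℝ} (hf : ContDiff ℝ (⊤ : ℕ∞) f) :
    dt (lap f) = lap (dt f) := by
  funext p
  rw [lap_eq, lap_eq, dt_eq]
  change fderiv ℝ (fun p => ∑ i : Fin 3, dirD (0, Pi.single i 1) (dirD (0, Pi.single i 1) f) p) p (1, 0) = _
  rw [fderiv_fun_sum (fun i _ => diff_of_smooth (dirD_smooth _ (dirD_smooth _ hf)) p)]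
  rw [ContinuousLinearMap.sum_apply]
  refine Finset.sum_congr rfl fun i _ => ?_
  change dirD (1, 0) (dirD (0, Pi.single i 1) (dirD (0, Pi.single i 1) f)) p = _
  rw [dirD_comm _ _ (dirD_smooth _ hf), dirD_comm (1, 0) _ hf, dt_eq]

theorem dirD_slice {f : ℝ × (Fin 3 → ℝ) → ℝ} (hf : ContDiff ℝ (⊤ : ℕ∞) f) (t₀ : ℝ)
    (h0 : ∀ x, f (t₀, x) = 0) (w : Fin 3 → ℝ) (x : Fin 3 → ℝ) : dirD (0, w) f (t₀, x) = 0 := by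
  have h1 : HasFDerivAt (fun y : Fin 3 → ℝ => f (t₀, y))
      ((fderiv ℝ f (t₀, x)).comp (ContinuousLinearMap.inr ℝ ℝ (Fin 3 → ℝ))) x :=
    (diff_of_smooth hf (t₀, x)).hasFDerivAt.comp x (hasFDerivAt_prodMk_right t₀ x)
  have h2 : HasFDerivAt (fun y : Fin 3 → ℝ => f (t₀, y)) (0 : (Fin 3 → ℝ) →L[ℝ] ℝ) x := by
    simp only [h0]
    exact hasFDerivAt_const _ _
  have := congrArg (fun L => L w) (h1.unique h2)
  simpa [dirD] using this

theorem iter_vanish (t₀ : ℝ) (n : ℕ) : ∀ u : ℝ × (Fin 3 → ℝ) → ℝ, ContDiff ℝ (⊤ : ℕ∞) u →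
    dt (dt u) = lap u → (∀ x, u (t₀, x) = 0) → (∀ x, dt u (t₀, x) = 0) →
    ∀ x, iteratedDeriv n (fun τ => u (τ, x)) t₀ = 0 := by
  induction n with
  | zero => intro u _ _ h0 _ x; simpa using h0 x
  | succ n ih =>
    intro u hu hw h0 h1 x
    have hder : deriv (fun τ => u (τ, x)) = fun τ => dt u (τ, x) := by
      funext τ
      have h : HasFDerivAt (fun τ : ℝ => u (τ, x))
          ((fderiv ℝ u (τ, x)).comp (ContinuousLinearMap.inl ℝ ℝ (Fin 3 → ℝ))) τ :=
        (diff_of_smooth hu (τ, x)).hasFDerivAt.comp τ (hasFDerivAt_prodMk_left τ x)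
      rw [h.hasDerivAt.deriv]
      simp [dt]
    rw [iteratedDeriv_succ', hder]
    refine ih (dt u) (dirD_smooth _ hu) ?_ h1 ?_ x
    · rw [hw, dt_lap hu]
    · intro y
      rw [hw, lap_eq]
      exact Finset.sum_eq_zero fun i _ => dirD_slice (dirD_smooth _ hu) t₀
        (fun z => dirD_slice hu t₀ h0 _ z) _ y

/-- **Uniqueness for the inhomogeneous wave equation with time-analytic data.**
Smooth solutions `A, A'` of `∂_t² A = Δ_x A − s` that are real-analytic in time
and share the initial data `A(t₀,·)` and `∂_t A(t₀,·)` coincide everywhere.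
This is the classical-field analogue of the photonic half of the van Leeuwen
theorem for QED. -/
theorem wave_equation_unique_from_initial_data
    (A A' s : ℝ × (Fin 3 → ℝ) → ℝ) (t₀ : ℝ)
    (hA : ContDiff ℝ (⊤ : ℕ∞) A) (hA' : ContDiff ℝ (⊤ : ℕ∞) A') (hs : ContDiff ℝ (⊤ : ℕ∞) s)
    (hAan : ∀ (x : Fin 3 → ℝ) (t : ℝ), AnalyticAt ℝ (fun τ => A (τ, x)) t)
    (hA'an : ∀ (x : Fin 3 → ℝ) (t : ℝ), AnalyticAt ℝ (fun τ => A' (τ, x)) t)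
    (hwave : ∀ p, dt (dt A) p = lap A p - s p)
    (hwave' : ∀ p, dt (dt A') p = lap A' p - s p)
    (hinit : ∀ x : Fin 3 → ℝ, A (t₀, x) = A' (t₀, x))
    (hinit' : ∀ x : Fin 3 → ℝ, dt A (t₀, x) = dt A' (t₀, x)) :
    A = A' := by
  have hu : ContDiff ℝ (⊤ : ℕ∞) (A - A') := hA.sub hA'
  have hdt : dt (A - A') = dt A - dt A' := dirD_sub _ hA hA'
  have hw : dt (dt (A - A')) = lap (A - A') := by
    have e : dt (dt (A - A')) = dt (dt A) - dt (dt A') := by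
      rw [hdt]
      exact dirD_sub _ (dirD_smooth _ hA) (dirD_smooth _ hA')
    rw [e]
    funext p
    have hl : lap (A - A') p = lap A p - lap A' p := by
      simp only [lap_eq, dirD_sub _ hA hA',
        dirD_sub _ (dirD_smooth _ hA) (dirD_smooth _ hA'), Pi.sub_apply, Finset.sum_sub_distrib]
    rw [hl, Pi.sub_apply, hwave, hwave']
    ring
  have hv := fun n => iter_vanish t₀ n (A - A') hu hw (fun x => by simp [hinit x])
    (fun x => by simp [hdt, hinit' x])
  funext ⟨t, x⟩
  have han : ∀ t, AnalyticAt ℝ (fun τ => (A - A') (τ, x)) t := fun t =>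
    (hAan x t).sub (hA'an x t)
  have htop : analyticOrderAt (fun τ => (A - A') (τ, x)) t₀ = ⊤ := by
    rw [ENat.eq_top_iff_forall_ge]
    intro n
    rw [natCast_le_analyticOrderAt_iff_iteratedDeriv_eq_zero (han t₀)]
    exact fun i _ => hv i x
  rw [analyticOrderAt_eq_top] at htop
  have hz := AnalyticOnNhd.eqOn_zero_of_preconnected_of_eventuallyEq_zero
    (U := Set.univ) (fun t _ => han t) isPreconnected_univ (Set.mem_univ t₀) htop
  have := hz (Set.mem_univ t)
  simpa [sub_eq_zero] using this
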